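/- arXiv:2303.17329 — 2 statements merged into one kernel-verified Lean document; each statement's English description precedes it below -/
import Mathlib

section
/- Let N be a positive integer, J, D, H ∈ ℝ^{N×N} with J skew-symmetric (Jᵀ = −J), D symmetric positive semidefinite, H symmetric positive definite, and let r : [t₀,T] → ℝ^N be continuous. If e : [t₀,T] → ℝ^N is continuously differentiable with ė(t) = (J−D)H e(t) + r(t) for all t ∈ [t₀,T] and e(t₀) = 0, then for all t ∈ [t₀,T] it holds that ‖e(t)‖_H ≤ ∫_{t₀}^{t} ‖r(s)‖_H ds (the standard error bound). -/
open Matrix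

/-- The energy norm `‖z‖_H := (zᵀ H z)^{1/2}` induced by a symmetric positive
definite matrix `H`. -/
noncomputable def energyNorm {N : ℕ} (H : Matrix (Fin N) (Fin N) ℝ)
    (z : Fin N → ℝ) : ℝ :=
  Real.sqrt (z ⬝ᵥ (H *ᵥ z))

theorem Matrix.IsHermitian.dotProduct_mulVec_comm {n : Type*} [Fintype n] {A : Matrix n n ℝ}
    (hA : A.IsHermitian) (x y : n → ℝ) : x ⬝ᵥ (A *ᵥ y) = y ⬝ᵥ (A *ᵥ x) := by
  have hT : Aᵀ = A := by simpa using hA.eq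
  rw [dotProduct_mulVec, ← mulVec_transpose, hT, dotProduct_comm]

theorem Matrix.dotProduct_mulVec_self_eq_zero_of_transpose_eq_neg {n : Type*} [Fintype n]
    {A : Matrix n n ℝ} (hA : Aᵀ = -A) (x : n → ℝ) : x ⬝ᵥ (A *ᵥ x) = 0 := by
  have h : x ⬝ᵥ (A *ᵥ x) = -(x ⬝ᵥ (A *ᵥ x)) := by
    conv_lhs => rw [dotProduct_mulVec, ← mulVec_transpose, hA, neg_mulVec, neg_dotProduct,
      dotProduct_comm]
  linarith

theorem Matrix.PosSemidef.dotProduct_mulVec_self_nonneg {n : Type*} [Fintype n]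
    {A : Matrix n n ℝ} (hA : A.PosSemidef) (x : n → ℝ) : 0 ≤ x ⬝ᵥ (A *ᵥ x) := by
  simpa using hA.dotProduct_mulVec_nonneg x

/-- Cauchy–Schwarz inequality for the form of a positive semidefinite matrix. -/
theorem Matrix.PosSemidef.dotProduct_mulVec_sq_le {n : Type*} [Fintype n]
    {A : Matrix n n ℝ} (hA : A.PosSemidef) (x y : n → ℝ) :
    (x ⬝ᵥ (A *ᵥ y)) ^ 2 ≤ (x ⬝ᵥ (A *ᵥ x)) * (y ⬝ᵥ (A *ᵥ y)) := by
  classical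
  have h := LinearMap.BilinForm.apply_mul_apply_le_of_forall_zero_le (Matrix.toBilin' A)
    (fun z => by simpa only [toBilin'_apply'] using hA.dotProduct_mulVec_self_nonneg z) x y
  simp only [toBilin'_apply'] at h
  rwa [hA.isHermitian.dotProduct_mulVec_comm y x, ← sq] at h

theorem HasDerivAt.dotProduct_mulVec_self {n : Type*} [Fintype n] {A : Matrix n n ℝ}
    (hA : A.IsHermitian) {e : ℝ → n → ℝ} {e' : n → ℝ} {t : ℝ} (he : HasDerivAt e e' t) :
    HasDerivAt (fun s => e s ⬝ᵥ (A *ᵥ e s)) (2 * (e t ⬝ᵥ (A *ᵥ e'))) t := by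
  have hAe : HasDerivAt (fun s => A *ᵥ e s) (A *ᵥ e') t :=
    (Matrix.mulVecLin A).toContinuousLinearMap.hasFDerivAt.comp_hasDerivAt t he
  have h : HasDerivAt (fun s => e s ⬝ᵥ (A *ᵥ e s))
      (e' ⬝ᵥ (A *ᵥ e t) + e t ⬝ᵥ (A *ᵥ e')) t := by
    simp only [dotProduct, ← Finset.sum_add_distrib]
    exact HasDerivAt.fun_sum fun i _ => (hasDerivAt_pi.1 he i).mul (hasDerivAt_pi.1 hAe i)
  rwa [hA.dotProduct_mulVec_comm e' (e t), ← two_mul] at h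

theorem continuous_energyNorm {N : ℕ} (H : Matrix (Fin N) (Fin N) ℝ) :
    Continuous (energyNorm H) := by
  unfold energyNorm
  fun_prop

theorem dotProduct_mulVec_le_energyNorm_mul {N : ℕ} {H : Matrix (Fin N) (Fin N) ℝ}
    (hH : H.PosSemidef) (x y : Fin N → ℝ) :
    x ⬝ᵥ (H *ᵥ y) ≤ energyNorm H x * energyNorm H y := by
  rw [energyNorm, energyNorm, ← Real.sqrt_mul (hH.dotProduct_mulVec_self_nonneg x)]
  exact Real.le_sqrt_of_sq_le (hH.dotProduct_mulVec_sq_le x y)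

/-- The power balance of a port-Hamiltonian system: the internal dynamics do not increase
the energy. -/
theorem dotProduct_mulVec_portHamiltonian_le {n : Type*} [Fintype n] {J D H : Matrix n n ℝ}
    (hJ : Jᵀ = -J) (hD : D.PosSemidef) (hH : H.IsHermitian) (x y : n → ℝ) :
    x ⬝ᵥ (H *ᵥ (((J - D) * H) *ᵥ x + y)) ≤ x ⬝ᵥ (H *ᵥ y) := by
  have h : x ⬝ᵥ (H *ᵥ (((J - D) * H) *ᵥ x)) =
      (H *ᵥ x) ⬝ᵥ (J *ᵥ (H *ᵥ x)) - (H *ᵥ x) ⬝ᵥ (D *ᵥ (H *ᵥ x)) := by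
    rw [hH.dotProduct_mulVec_comm, dotProduct_comm, ← mulVec_mulVec, sub_mulVec, dotProduct_sub]
  rw [mulVec_add, dotProduct_add, h, dotProduct_mulVec_self_eq_zero_of_transpose_eq_neg hJ]
  linarith [hD.dotProduct_mulVec_self_nonneg (H *ᵥ x)]


/-- Standard error bound: a solution of the error system
`ė(t) = (J−D)H e(t) + r(t)`, `e(t₀) = 0`, of a port-Hamiltonian system satisfies
`‖e(t)‖_H ≤ ∫_{t₀}^{t} ‖r(s)‖_H ds`. -/
theorem standard_error_bound
    (N : ℕ) (hN : 0 < N)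
    (J D H : Matrix (Fin N) (Fin N) ℝ)
    (hJ : Jᵀ = -J) (hD : D.PosSemidef) (hH : H.PosDef)
    (t₀ T : ℝ) (hT : t₀ ≤ T)
    (r : ℝ → Fin N → ℝ) (hr : ContinuousOn r (Set.Icc t₀ T))
    (e : ℝ → Fin N → ℝ)
    (he : ∀ t ∈ Set.Icc t₀ T, HasDerivAt e (((J - D) * H) *ᵥ e t + r t) t)
    (he0 : e t₀ = 0) :
    ∀ t ∈ Set.Icc t₀ T,
      energyNorm H (e t) ≤ ∫ s in t₀..t, energyNorm H (r s) := by
  intro t ht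
  set E : ℝ → ℝ := fun s => e s ⬝ᵥ (H *ᵥ e s)
  have hE : ∀ s, 0 ≤ E s := fun s => hH.posSemidef.dotProduct_mulVec_self_nonneg (e s)
  have hrc : ContinuousOn (fun s => energyNorm H (r s)) (Set.Icc t₀ T) :=
    (continuous_energyNorm H).comp_continuousOn hr
  refine le_of_forall_pos_le_add fun ε hε => ?_
  have hpos : ∀ s, 0 < E s + ε ^ 2 := fun s => add_pos_of_nonneg_of_pos (hE s) (pow_pos hε 2)
  have hderiv : ∀ s ∈ Set.Icc t₀ T, HasDerivAt (fun s => √(E s + ε ^ 2))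
      (2 * (e s ⬝ᵥ (H *ᵥ (((J - D) * H) *ᵥ e s + r s))) / (2 * √(E s + ε ^ 2))) s :=
    fun s hs => (((he s hs).dotProduct_mulVec_self hH.isHermitian).add_const _).sqrt (hpos s).ne'
  have key := image_le_of_deriv_right_le_deriv_boundary
    (B := fun s => (∫ u in t₀..s, energyNorm H (r u)) + ε)
    (B' := fun s => energyNorm H (r s))
    (fun s hs => (hderiv s hs).continuousAt.continuousWithinAt)
    (fun s hs => (hderiv s (Set.Ico_subset_Icc_self hs)).hasDerivWithinAt)
    (by simp [E, he0, Real.sqrt_sq hε.le])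
    (by
      have h := intervalIntegral.continuousOn_primitive_interval (μ := MeasureTheory.volume)
        (a := t₀) (b := T) (f := fun s => energyNorm H (r s))
        (by rw [Set.uIcc_of_le hT]; exact hrc.integrableOn_Icc)
      rw [Set.uIcc_of_le hT] at h
      exact h.add continuousOn_const)
    (fun s hs => by
      have hnhds : Set.Icc t₀ T ∈ nhdsWithin s (Set.Ioi s) :=
        Filter.mem_of_superset (Ioo_mem_nhdsGT hs.2)
          fun u hu => ⟨hs.1.trans hu.1.le, hu.2.le⟩
      refine (intervalIntegral.integral_hasDerivWithinAt_right (t := Set.Ioi s) ?_ ?_ ?_).add_const _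
      · exact (hrc.mono (Set.Icc_subset_Icc_right hs.2.le)).intervalIntegrable_of_Icc hs.1
      · exact ⟨_, hnhds, hrc.aestronglyMeasurable measurableSet_Icc⟩
      · exact (hrc s (Set.Ico_subset_Icc_self hs)).mono_of_mem_nhdsWithin hnhds)
    (fun s _ => by
      have hsqrt : 0 < √(E s + ε ^ 2) := Real.sqrt_pos.2 (hpos s)
      rw [mul_div_mul_left _ _ two_ne_zero, div_le_iff₀ hsqrt, mul_comm]
      calc e s ⬝ᵥ (H *ᵥ (((J - D) * H) *ᵥ e s + r s))
          ≤ e s ⬝ᵥ (H *ᵥ r s) := dotProduct_mulVec_portHamiltonian_le hJ hD hH.isHermitian _ _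
        _ ≤ energyNorm H (e s) * energyNorm H (r s) :=
          dotProduct_mulVec_le_energyNorm_mul hH.posSemidef _ _
        _ ≤ √(E s + ε ^ 2) * energyNorm H (r s) :=
          mul_le_mul_of_nonneg_right (Real.sqrt_le_sqrt (le_add_of_nonneg_right (sq_nonneg ε)))
            (Real.sqrt_nonneg _))
    ht
  exact (Real.sqrt_le_sqrt (le_add_of_nonneg_right (sq_nonneg ε))).trans key
end

section
/- Let N be a positive integer, J, D, H ∈ ℝ^{N×N} with J skew-symmetric, D symmetric positive semidefinite, H symmetric positive definite, B ∈ ℝ^{N×m}, u continuous. Let x : [t₀,T] → ℝ^N solve ẋ = (J−D)Hx + Bu with x(t₀) = x₀, let V ∈ ℝ^{N×n} and V_H ∈ ℝ^{N×n_H} have full column rank, let x_r solve the reduced system VᵀHV ẋ_r = VᵀH(J−D)HV x_r + VᵀHBu with x₀ = V x_r(t₀), and let x_{H,r} solve the hierarchical reduced system V_HᵀHV_H ẋ_{H,r} = V_HᵀH(J−D)HV_H x_{H,r} + V_HᵀHBu with x₀ = V_H x_{H,r}(t₀). Set x̂(t) := V x_r(t), x̂_H(t) := V_H x_{H,r}(t),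 P_H := I_N − V_H(V_HᵀHV_H)⁻¹V_HᵀH, and r_H(t) := P_H (J−D)H x̂_H(t) + P_H B u(t). Then for all t ∈ [t₀,T], ‖x(t) − x̂(t)‖_H ≤ Δ_H(t) := ‖x̂_H(t) − x̂(t)‖_H + ∫_{t₀}^{t} ‖r_H(s)‖_H ds (the hierarchical error bound). -/
open Matrix

/-- The projection operator `P := I − V (VᵀHV)⁻¹ VᵀH` associated with a reduced
basis `V` and a symmetric positive definite matrix `H`. -/
noncomputable def proj {N n : ℕ} (H : Matrix (Fin N) (Fin N) ℝ)
    (V : Matrix (Fin N) (Fin n) ℝ) : Matrix (Fin N) (Fin N) ℝ :=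
  1 - V * (Vᵀ * H * V)⁻¹ * (Vᵀ * H)

open MeasureTheory in
/-- A differentiable curve in a real inner product space whose norm grows at rate at most `ρ`, in
the sense that `⟪e, e'⟫ ≤ ‖e‖ ρ`, satisfies `‖e b‖ ≤ ‖e a‖ + ∫ ρ`. -/
theorem norm_le_norm_add_integral_of_inner_le {F : Type*} [NormedAddCommGroup F]
    [InnerProductSpace ℝ F] {e e' : ℝ → F} {ρ : ℝ → ℝ} {a b : ℝ} (hab : a ≤ b)
    (he : ∀ s ∈ Set.Icc a b, HasDerivAt e (e' s) s) (hρ : IntegrableOn ρ (Set.Icc a b))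
    (hρ0 : ∀ s ∈ Set.Icc a b, 0 ≤ ρ s)
    (hinner : ∀ s ∈ Set.Icc a b, inner ℝ (e s) (e' s) ≤ ‖e s‖ * ρ s) :
    ‖e b‖ ≤ ‖e a‖ + ∫ s in a..b, ρ s := by
  refine le_of_forall_pos_le_add fun ε hε => ?_
  -- The norm is regularised to `√(‖e‖² + ε²)`, which is differentiable at zeros of `e`.
  have hpos : ∀ s, 0 < ‖e s‖ ^ 2 + ε ^ 2 := fun s => by positivity
  have hderiv : ∀ s ∈ Set.Icc a b, HasDerivAt (fun s => √(‖e s‖ ^ 2 + ε ^ 2))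
      (2 * inner ℝ (e s) (e' s) / (2 * √(‖e s‖ ^ 2 + ε ^ 2))) s := fun s hs =>
    ((he s hs).norm_sq.add_const (ε ^ 2)).sqrt (hpos s).ne'
  have hle : ∀ s, ‖e s‖ ≤ √(‖e s‖ ^ 2 + ε ^ 2) := fun s =>
    Real.le_sqrt_of_sq_le (by nlinarith [sq_nonneg ε])
  have hgrowth := intervalIntegral.sub_le_integral_of_hasDeriv_right_of_le hab
    (fun s hs => (hderiv s hs).continuousAt.continuousWithinAt)
    (fun s hs => (hderiv s (Set.Ioo_subset_Icc_self hs)).hasDerivWithinAt) hρ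
    (fun s hs => by
      have hs' := Set.Ioo_subset_Icc_self hs
      rw [mul_div_mul_left _ _ two_ne_zero, div_le_iff₀ (Real.sqrt_pos.2 (hpos s))]
      nlinarith [hinner s hs', mul_le_mul_of_nonneg_right (hle s) (hρ0 s hs')])
  have hstart : √(‖e a‖ ^ 2 + ε ^ 2) ≤ ‖e a‖ + ε :=
    Real.sqrt_le_iff.2 ⟨by positivity, by nlinarith [mul_nonneg (norm_nonneg (e a)) hε.le]⟩
  linarith [hle b]

open scoped MatrixOrder Matrix.Norms.L2Operator in
/-- The bilinear form of a positive semidefinite matrix is the pullback of the Euclidean inner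
product along a linear map. -/
theorem Matrix.PosSemidef.exists_inner_eq_dotProduct_mulVec {N : ℕ}
    {H : Matrix (Fin N) (Fin N) ℝ} (hH : H.PosSemidef) :
    ∃ L : (Fin N → ℝ) →L[ℝ] EuclideanSpace ℝ (Fin N),
      ∀ y z, inner ℝ (L y) (L z) = y ⬝ᵥ (H *ᵥ z) := by
  obtain ⟨C, rfl⟩ := CStarAlgebra.nonneg_iff_eq_star_mul_self.mp hH.nonneg
  refine ⟨(EuclideanSpace.equiv (Fin N) ℝ).symm.toContinuousLinearMap.comp
    (LinearMap.toContinuousLinearMap C.mulVecLin), fun y z => ?_⟩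
  change inner ℝ (WithLp.toLp 2 (C *ᵥ y)) (WithLp.toLp 2 (C *ᵥ z)) = _
  rw [EuclideanSpace.inner_toLp_toLp, star_trivial, star_eq_conjTranspose,
    conjTranspose_eq_transpose_of_trivial, ← mulVec_mulVec, dotProduct_mulVec y,
    vecMul_transpose, dotProduct_comm]

theorem hasDerivAt_mulVec {N n : ℕ} (M : Matrix (Fin N) (Fin n) ℝ) {y : ℝ → Fin n → ℝ}
    {y' : Fin n → ℝ} {t : ℝ} (hy : HasDerivAt y y' t) :
    HasDerivAt (fun s => M *ᵥ y s) (M *ᵥ y') t :=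
  (LinearMap.toContinuousLinearMap M.mulVecLin).hasFDerivAt.comp_hasDerivAt t hy

/-- The operator `(J - D) H` of a port-Hamiltonian system is dissipative in the energy inner
product. -/
theorem dotProduct_mulVec_portHamiltonian_nonpos {N : ℕ} {J D H : Matrix (Fin N) (Fin N) ℝ}
    (hJ : Jᵀ = -J) (hD : D.PosSemidef) (hH : Hᵀ = H) (z : Fin N → ℝ) :
    z ⬝ᵥ (H *ᵥ (((J - D) * H) *ᵥ z)) ≤ 0 := by
  have hskew : (H *ᵥ z) ⬝ᵥ (J *ᵥ (H *ᵥ z)) = 0 := by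
    have h : (H *ᵥ z) ⬝ᵥ (J *ᵥ (H *ᵥ z)) = -((H *ᵥ z) ⬝ᵥ (J *ᵥ (H *ᵥ z))) := by
      conv_lhs => rw [dotProduct_mulVec, ← mulVec_transpose, hJ, neg_mulVec, neg_dotProduct,
        dotProduct_comm]
    linarith
  have hdiss := hD.dotProduct_mulVec_nonneg (H *ᵥ z)
  rw [star_trivial] at hdiss
  rw [dotProduct_mulVec z H, ← mulVec_transpose, hH, ← mulVec_mulVec, sub_mulVec,
    dotProduct_sub, hskew]
  linarith

/-- The projection `proj H W` sends `z` to the residual `z - W y`, where `y` solves the Galerkin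
equations for `z`. -/
theorem proj_mulVec_eq_sub {N n : ℕ} {H : Matrix (Fin N) (Fin N) ℝ} (hH : H.PosDef)
    {W : Matrix (Fin N) (Fin n) ℝ} (hW : Function.Injective W.mulVec) {z : Fin N → ℝ}
    {y : Fin n → ℝ} (hy : (Wᵀ * H * W) *ᵥ y = (Wᵀ * H) *ᵥ z) :
    proj H W *ᵥ z = z - W *ᵥ y := by
  have hG : (Wᵀ * H * W).PosDef := by
    simpa only [conjTranspose_eq_transpose_of_trivial] using hH.conjTranspose_mul_mul_same hW
  have hdet := (isUnit_iff_isUnit_det _).1 hG.isUnit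
  rw [proj, sub_mulVec, one_mulVec, ← mulVec_mulVec, ← hy, mulVec_mulVec,
    nonsing_inv_mul_cancel_right _ _ hdet]

/-- Hierarchical error bound: with a primal reduced approximation `x̂ = V x_r`
and a finer hierarchical reduced approximation `x̂_H = V_H x_{H,r}`,
`‖x(t) − x̂(t)‖_H ≤ ‖x̂_H(t) − x̂(t)‖_H + ∫_{t₀}^{t} ‖r_H(s)‖_H ds` with
`r_H = P_H (J−D)H x̂_H + P_H B u`. -/
theorem hierarchical_error_bound
    (N n nH m : ℕ) (hN : 0 < N)
    (J D H : Matrix (Fin N) (Fin N) ℝ)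
    (hJ : Jᵀ = -J) (hD : D.PosSemidef) (hH : H.PosDef)
    (B : Matrix (Fin N) (Fin m) ℝ)
    (t₀ T : ℝ) (hT : t₀ ≤ T)
    (u : ℝ → Fin m → ℝ) (hu : ContinuousOn u (Set.Icc t₀ T))
    (x : ℝ → Fin N → ℝ) (x₀ : Fin N → ℝ)
    (hx : ∀ t ∈ Set.Icc t₀ T, HasDerivAt x (((J - D) * H) *ᵥ x t + B *ᵥ u t) t)
    (hx0 : x t₀ = x₀)
    (V : Matrix (Fin N) (Fin n) ℝ) (hV : Function.Injective V.mulVec)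
    (VH : Matrix (Fin N) (Fin nH) ℝ) (hVH : Function.Injective VH.mulVec)
    (xr xr' : ℝ → Fin n → ℝ)
    (hxr : ∀ t ∈ Set.Icc t₀ T, HasDerivAt xr (xr' t) t)
    (hred : ∀ t ∈ Set.Icc t₀ T,
      (Vᵀ * H * V) *ᵥ xr' t
        = (Vᵀ * H * ((J - D) * H) * V) *ᵥ xr t + (Vᵀ * H * B) *ᵥ u t)
    (hxr0 : x₀ = V *ᵥ xr t₀)
    (xHr xHr' : ℝ → Fin nH → ℝ)
    (hxHr : ∀ t ∈ Set.Icc t₀ T, HasDerivAt xHr (xHr' t) t)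
    (hredH : ∀ t ∈ Set.Icc t₀ T,
      (VHᵀ * H * VH) *ᵥ xHr' t
        = (VHᵀ * H * ((J - D) * H) * VH) *ᵥ xHr t + (VHᵀ * H * B) *ᵥ u t)
    (hxHr0 : x₀ = VH *ᵥ xHr t₀) :
    ∀ t ∈ Set.Icc t₀ T,
      energyNorm H (x t - V *ᵥ xr t)
        ≤ energyNorm H (VH *ᵥ xHr t - V *ᵥ xr t)
          + ∫ s in t₀..t,
              energyNorm H ((proj H VH) *ᵥ (((J - D) * H) *ᵥ (VH *ᵥ xHr s))
                + (proj H VH) *ᵥ (B *ᵥ u s)) := by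
  obtain ⟨L, hL⟩ := hH.posSemidef.exists_inner_eq_dotProduct_mulVec
  have hnorm : ∀ z, energyNorm H z = ‖L z‖ := fun z => by
    rw [energyNorm, ← hL, norm_eq_sqrt_real_inner]
  have hHT : Hᵀ = H := by simpa only [conjTranspose_eq_transpose_of_trivial] using hH.isHermitian.eq
  intro t ht
  have hsub : Set.Icc t₀ t ⊆ Set.Icc t₀ T := Set.Icc_subset_Icc_right ht.2
  simp only [hnorm]
  set r : ℝ → Fin N → ℝ := fun s => proj H VH *ᵥ (((J - D) * H) *ᵥ (VH *ᵥ xHr s))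
    + proj H VH *ᵥ (B *ᵥ u s) with hr
  have hres : ∀ s ∈ Set.Icc t₀ T,
      r s = ((J - D) * H) *ᵥ (VH *ᵥ xHr s) + B *ᵥ u s - VH *ᵥ xHr' s := fun s hs => by
    rw [hr]
    dsimp only
    rw [← mulVec_add]
    refine proj_mulVec_eq_sub hH hVH ?_
    rw [hredH s hs, mulVec_add, mulVec_mulVec, mulVec_mulVec, mulVec_mulVec, Matrix.mul_assoc]
  have hcont : ContinuousOn (fun s => ‖L (r s)‖) (Set.Icc t₀ T) := by
    have hxc : ContinuousOn xHr (Set.Icc t₀ T) :=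
      fun s hs => (hxHr s hs).continuousAt.continuousWithinAt
    have hmul : ∀ {k l : ℕ} (M : Matrix (Fin k) (Fin l) ℝ), Continuous M.mulVec := fun M =>
      continuous_const.matrix_mulVec continuous_id
    refine (L.continuous.comp_continuousOn (ContinuousOn.add ?_ ?_)).norm
    · exact ((hmul _).comp ((hmul _).comp (hmul _))).comp_continuousOn hxc
    · exact ((hmul _).comp (hmul _)).comp_continuousOn hu
  have herr : ‖L (x t - VH *ᵥ xHr t)‖ ≤ ∫ s in t₀..t, ‖L (r s)‖ := by
    have h := norm_le_norm_add_integral_of_inner_le (e := fun s => L (x s - VH *ᵥ xHr s)) ht.1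
      (fun s hs => L.hasFDerivAt.comp_hasDerivAt s
        ((hx s (hsub hs)).sub (hasDerivAt_mulVec VH (hxHr s (hsub hs)))))
      (hcont.mono hsub).integrableOn_Icc (fun _ _ => norm_nonneg _) (fun s hs => ?_)
    · simpa [hx0, ← hxHr0] using h
    · have hsplit : ((J - D) * H) *ᵥ x s + B *ᵥ u s - VH *ᵥ xHr' s
          = ((J - D) * H) *ᵥ (x s - VH *ᵥ xHr s) + r s := by
        rw [hres s (hsub hs), mulVec_sub]
        abel
      rw [hsplit, map_add, inner_add_right, hL]
      linarith [dotProduct_mulVec_portHamiltonian_nonpos hJ hD hHT (x s - VH *ᵥ xHr s),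
        real_inner_le_norm (L (x s - VH *ᵥ xHr s)) (L (r s))]
  calc ‖L (x t - V *ᵥ xr t)‖
      = ‖L (VH *ᵥ xHr t - V *ᵥ xr t) + L (x t - VH *ᵥ xHr t)‖ := by
        rw [← map_add]
        congr 2
        abel
    _ ≤ ‖L (VH *ᵥ xHr t - V *ᵥ xr t)‖ + ‖L (x t - VH *ᵥ xHr t)‖ := norm_add_le _ _
    _ ≤ _ := by gcongr
end
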